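/- With the recursion D_{u,0} = δ_{u,0} and D_{u,v} = (1/v) Σ_{i=0}^u D_{i,1} D_{u−i,v−1} for commuting elements D_{i,1} of a ℚ-algebra, one has for all u ≥ 0, v ≥ 1: u·D_{u,v} = Σ_{i=0}^u i·D_{i,1} D_{u−i,v−1}, and consequently (u+v)·D_{u,v} = Σ_{i=0}^u (i+1)·D_{i,1} D_{u−i,v−1}. -/

import Mathlib

open Finset

noncomputable section

variable {R : Type*} [Ring R] [Algebra ℚ R]

/-- `D_{u,v}` defined by `D_{u,0} = δ_{u,0}` and
`D_{u,v} = (1/v) ∑_{i=0}^u D_{i,1} D_{u-i,v-1}`, with `D_{i,1} := d i`. -/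
def DvGen (d : ℕ → R) : ℕ → ℕ → R
  | u, 0 => if u = 0 then 1 else 0
  | u, v + 1 => (((v : ℚ) + 1)⁻¹) • ∑ i ∈ Finset.range (u + 1), d i * DvGen d (u - i) v

theorem sum_antidiagonal_antidiagonal_comm {M : Type*} [AddCommMonoid M] (f : ℕ → ℕ → ℕ → M)
    (n : ℕ) :
    ∑ p ∈ antidiagonal n, ∑ q ∈ antidiagonal p.2, f p.1 q.1 q.2 =
      ∑ p ∈ antidiagonal n, ∑ q ∈ antidiagonal p.2, f q.1 p.1 q.2 := by
  rw [sum_sigma', sum_sigma']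
  refine sum_nbij' (fun x => ⟨(x.2.1, x.1.1 + x.2.2), (x.1.1, x.2.2)⟩)
    (fun x => ⟨(x.2.1, x.1.1 + x.2.2), (x.1.1, x.2.2)⟩) ?_ ?_ ?_ ?_ ?_
  · rintro ⟨⟨a, b⟩, ⟨c, e⟩⟩ h
    simp only [mem_sigma, HasAntidiagonal.mem_antidiagonal] at h ⊢
    exact ⟨by rw [← h.1, ← h.2, add_left_comm], trivial⟩
  · rintro ⟨⟨a, b⟩, ⟨c, e⟩⟩ h
    simp only [mem_sigma, HasAntidiagonal.mem_antidiagonal] at h ⊢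
    exact ⟨by rw [← h.1, ← h.2, add_left_comm], trivial⟩
  · rintro ⟨⟨a, b⟩, ⟨c, e⟩⟩ h
    simp only [mem_sigma, HasAntidiagonal.mem_antidiagonal] at h
    obtain ⟨-, rfl⟩ := h
    rfl
  · rintro ⟨⟨a, b⟩, ⟨c, e⟩⟩ h
    simp only [mem_sigma, HasAntidiagonal.mem_antidiagonal] at h
    obtain ⟨-, rfl⟩ := h
    rfl
  · intro _ _
    rfl

theorem succ_nsmul_DvGen_succ (d : ℕ → R) (u v : ℕ) :
    (v + 1) • DvGen d u (v + 1) = ∑ p ∈ antidiagonal u, d p.1 * DvGen d p.2 v := by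
  rw [Nat.sum_antidiagonal_eq_sum_range_succ (fun i j => d i * DvGen d j v), DvGen,
    ← Nat.cast_smul_eq_nsmul ℚ, smul_smul, Nat.cast_succ,
    mul_inv_cancel₀ (Nat.cast_add_one_ne_zero v), one_smul]

theorem nsmul_sum_antidiagonal_mul_DvGen (d : ℕ → R) (u v : ℕ) :
    u • ∑ p ∈ antidiagonal u, d p.1 * DvGen d p.2 v =
      ∑ p ∈ antidiagonal u, p.1 • (d p.1 * DvGen d p.2 v) +
        ∑ p ∈ antidiagonal u, d p.1 * (p.2 • DvGen d p.2 v) := by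
  rw [smul_sum, ← sum_add_distrib]
  refine sum_congr rfl fun p hp => ?_
  rw [← HasAntidiagonal.mem_antidiagonal.mp hp, add_smul, mul_smul_comm]

theorem nsmul_DvGen_succ (d : ℕ → R) (hcomm : ∀ a b : ℕ, Commute (d a) (d b)) (u v : ℕ) :
    u • DvGen d u (v + 1) = ∑ p ∈ antidiagonal u, p.1 • (d p.1 * DvGen d p.2 v) := by
  induction v generalizing u with
  | zero =>
    have h := nsmul_sum_antidiagonal_mul_DvGen d u 0
    rw [← succ_nsmul_DvGen_succ, zero_add, one_smul] at h
    rw [zero_add, h, add_eq_left]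
    refine sum_eq_zero fun p _ => ?_
    by_cases hp : p.2 = 0 <;> simp [DvGen, hp]
  | succ v ih =>
    have tail : ∑ p ∈ antidiagonal u, d p.1 * (p.2 • DvGen d p.2 (v + 1)) =
        (v + 1) • ∑ p ∈ antidiagonal u, p.1 • (d p.1 * DvGen d p.2 (v + 1)) := by
      calc
        _ = ∑ p ∈ antidiagonal u, ∑ q ∈ antidiagonal p.2,
              q.1 • (d p.1 * (d q.1 * DvGen d q.2 v)) := by
          refine sum_congr rfl fun p _ => ?_
          simp only [ih, mul_sum, mul_smul_comm]
        _ = ∑ p ∈ antidiagonal u, ∑ q ∈ antidiagonal p.2,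
              p.1 • (d q.1 * (d p.1 * DvGen d q.2 v)) :=
          sum_antidiagonal_antidiagonal_comm
            (fun i k l => k • (d i * (d k * DvGen d l v))) u
        _ = _ := by
          rw [smul_sum]
          refine sum_congr rfl fun p _ => ?_
          rw [smul_comm, ← mul_smul_comm (v + 1), succ_nsmul_DvGen_succ, mul_sum, smul_sum]
          refine sum_congr rfl fun q _ => ?_
          rw [← mul_assoc, ← mul_assoc, (hcomm q.1 p.1).eq]
    have h := nsmul_sum_antidiagonal_mul_DvGen d u (v + 1)
    rw [tail, ← succ_nsmul_DvGen_succ, smul_comm, ← succ_nsmul'] at h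
    have : IsAddTorsionFree R := .of_module_rat R
    exact nsmul_right_injective (Nat.succ_ne_zero (v + 1)) h

/-- `u D_{u,v} = ∑_{i=0}^u i D_{i,1} D_{u-i,v-1}` and consequently
`(u+v) D_{u,v} = ∑_{i=0}^u (i+1) D_{i,1} D_{u-i,v-1}` for `v ≥ 1`. -/
theorem DvGen_smul_identities (d : ℕ → R)
    (hcomm : ∀ a b : ℕ, Commute (d a) (d b)) (u v : ℕ) (hv : 1 ≤ v) :
    u • DvGen d u v = ∑ i ∈ Finset.range (u + 1), i • (d i * DvGen d (u - i) (v - 1)) ∧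
      (u + v) • DvGen d u v =
        ∑ i ∈ Finset.range (u + 1), (i + 1) • (d i * DvGen d (u - i) (v - 1)) := by
  obtain ⟨v, rfl⟩ := Nat.exists_eq_add_of_le' hv
  have h : u • DvGen d u (v + 1) =
      ∑ i ∈ Finset.range (u + 1), i • (d i * DvGen d (u - i) v) :=
    (nsmul_DvGen_succ d hcomm u v).trans
      (Nat.sum_antidiagonal_eq_sum_range_succ (fun i j => i • (d i * DvGen d j v)) u)
  refine ⟨h, ?_⟩
  rw [add_smul, h, succ_nsmul_DvGen_succ,
    Nat.sum_antidiagonal_eq_sum_range_succ (fun i j => d i * DvGen d j v), ← sum_add_distrib]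
  exact sum_congr rfl fun i _ => (succ_nsmul _ i).symm
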